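/- arXiv:1208.0946 — 7 statements merged into one kernel-verified Lean document; each statement's English description precedes it below -/
import Mathlib

section
/- For all nonempty subsets S ⊆ T ⊊ V and every vertex v ∈ V \ T, the system error satisfies R(S) − R(S ∪ {v}) ≥ R(T) − R(T ∪ {v}); that is, R is a supermodular function of the leader set S. -/
open Matrix Finset

/-- The grounded Laplacian: the principal submatrix of `L` obtained by deleting the rows and
columns indexed by the set `S`. -/
noncomputable def grounded {V : Type*} [Fintype V] [DecidableEq V]
    (L : Matrix V V ℝ) (S : Finset V) : Matrix {x : V // x ∉ S} {x : V // x ∉ S} ℝ :=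
  L.submatrix (fun i => (i : V)) (fun j => (j : V))

/-- The system error `R(S) = (1/2) · trace((L_S)⁻¹)` (equal to `0` when `S = V`). -/
noncomputable def sysError {V : Type*} [Fintype V] [DecidableEq V]
    (L : Matrix V V ℝ) (S : Finset V) : ℝ :=
  (1 / 2 : ℝ) * Matrix.trace (grounded L S)⁻¹

/-- The Green function of the grounded Laplacian: the inverse of `grounded L S`, extended by zero
to all of `V × V`. -/
noncomputable def green {V : Type*} [Fintype V] [DecidableEq V]
    (L : Matrix V V ℝ) (S : Finset V) (x y : V) : ℝ :=
  if h : x ∉ S ∧ y ∉ S then (grounded L S)⁻¹ ⟨x, h.1⟩ ⟨y, h.2⟩ else 0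

section Green

variable {V : Type*} [Fintype V] [DecidableEq V] {L : Matrix V V ℝ} {S T : Finset V}

/-- A sum of a function vanishing on `S` is a sum over the complement of `S`. -/
lemma sum_eq_sum_subtype_notMem (f : V → ℝ) (hf : ∀ x ∈ S, f x = 0) :
    ∑ x, f x = ∑ x : {x : V // x ∉ S}, f x := by
  rw [← Finset.sum_subtype (Finset.univ.filter fun x => x ∉ S) (by simp) f]
  symm
  apply Finset.sum_subset (Finset.subset_univ _)
  intro x _ hx
  exact hf x (by simpa using hx)

/-- Minimum principle: a function that is nonnegative on `S` and superharmonic off `S` is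
nonnegative. -/
lemma nonneg_of_superharmonic (hoff : ∀ i j : V, i ≠ j → L i j ≤ 0)
    (hpd : (grounded L S).PosDef) (w : V → ℝ) (hw : ∀ x ∈ S, 0 ≤ w x)
    (hLw : ∀ x ∉ S, 0 ≤ ∑ y, L x y * w y) (x : V) : 0 ≤ w x := by
  set n : V → ℝ := fun x => max (-w x) 0
  have hnS : ∀ x ∈ S, n x = 0 := fun x hx => max_eq_right (by linarith [hw x hx])
  have hn0 : ∀ x, 0 ≤ n x := fun x => le_max_right _ _
  have h1 : 0 ≤ ∑ x, n x * ∑ y, L x y * w y := by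
    refine Finset.sum_nonneg fun x _ => ?_
    by_cases hx : x ∈ S
    · simp [hnS x hx]
    · exact mul_nonneg (hn0 x) (hLw x hx)
  have h2 : ∑ x, n x * ∑ y, L x y * w y ≤ -∑ x, n x * ∑ y, L x y * n y := by
    rw [← Finset.sum_neg_distrib]
    refine Finset.sum_le_sum fun x _ => ?_
    rw [← mul_neg, ← Finset.sum_neg_distrib, Finset.mul_sum, Finset.mul_sum]
    refine Finset.sum_le_sum fun y _ => ?_
    have hp : 0 ≤ w y + n y := by linarith [le_max_left (-w y) 0]
    by_cases hxy : x = y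
    · subst hxy
      rcases le_total 0 (w x) with h | h
      · have : n x = 0 := max_eq_right (by linarith)
        simp [this]
      · have : n x = -w x := max_eq_left (by linarith)
        simp [this]
    · nlinarith [mul_nonneg (mul_nonneg (hn0 x) hp) (neg_nonneg.2 (hoff x y hxy))]
  have h3 : ∑ x, n x * ∑ y, L x y * n y =
      (fun x : {x : V // x ∉ S} => n x) ⬝ᵥ (grounded L S *ᵥ fun x => n x) := by
    rw [sum_eq_sum_subtype_notMem _ fun x hx => by simp [hnS x hx]]
    refine Finset.sum_congr rfl fun x _ => ?_
    rw [sum_eq_sum_subtype_notMem _ fun y hy => by simp [hnS y hy]]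
    rfl
  have h4 : (fun x : {x : V // x ∉ S} => n x) = 0 := by
    by_contra hne
    have := hpd.dotProduct_mulVec_pos hne
    rw [star_trivial, ← h3] at this
    linarith
  by_cases hx : x ∈ S
  · exact hw x hx
  · have h5 : n x = 0 := congrFun h4 ⟨x, hx⟩
    linarith [le_max_left (-w x) 0]

/-- A function that vanishes on `S` and is harmonic off `S` vanishes. -/
lemma eq_zero_of_harmonic (hoff : ∀ i j : V, i ≠ j → L i j ≤ 0)
    (hpd : (grounded L S).PosDef) (w : V → ℝ) (hw : ∀ x ∈ S, w x = 0)
    (hLw : ∀ x ∉ S, ∑ y, L x y * w y = 0) (x : V) : w x = 0 := by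
  refine le_antisymm ?_ (nonneg_of_superharmonic hoff hpd w (fun x hx => (hw x hx).ge)
    (fun x hx => (hLw x hx).ge) x)
  have := nonneg_of_superharmonic hoff hpd (fun x => -w x) (fun x hx => by simp [hw x hx])
    (fun x hx => by simp [hLw x hx]) x
  linarith

lemma green_of_mem_left {x : V} (hx : x ∈ S) (y : V) : green L S x y = 0 := by
  simp [green, hx]

lemma green_comm (hsymm : L.IsSymm) (x y : V) : green L S x y = green L S y x := by
  have h : ((grounded L S)⁻¹)ᵀ = (grounded L S)⁻¹ := by
    rw [Matrix.transpose_nonsing_inv]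
    congr 1
    ext i j
    exact hsymm.apply _ _
  unfold green
  by_cases hxy : x ∉ S ∧ y ∉ S
  · rw [dif_pos hxy, dif_pos hxy.symm]
    exact congrFun (congrFun h.symm _) _
  · rw [dif_neg hxy, dif_neg fun h' => hxy h'.symm]

/-- Off `S`, the Laplacian of a column of the Green function is a point mass. -/
lemma laplacian_green (hpd : (grounded L S).PosDef) {x y : V} (hx : x ∉ S) (hy : y ∉ S) :
    ∑ z, L x z * green L S z y = if x = y then 1 else 0 := by
  have h := congrFun (congrFun (Matrix.mul_nonsing_inv (grounded L S)
    ((Matrix.isUnit_iff_isUnit_det _).1 hpd.isUnit)) ⟨x, hx⟩) ⟨y, hy⟩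
  rw [Matrix.mul_apply, Matrix.one_apply] at h
  rw [sum_eq_sum_subtype_notMem _ fun z hz => by rw [green_of_mem_left hz, mul_zero]]
  simp only [Subtype.mk.injEq] at h
  rw [← h]
  refine Finset.sum_congr rfl fun z _ => ?_
  simp [green, z.2, hy, grounded]

lemma green_nonneg (hoff : ∀ i j : V, i ≠ j → L i j ≤ 0) (hpd : (grounded L S).PosDef)
    {y : V} (hy : y ∉ S) (x : V) : 0 ≤ green L S x y := by
  refine nonneg_of_superharmonic hoff hpd (green L S · y)
    (fun x hx => (green_of_mem_left hx y).ge) (fun x hx => ?_) x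
  rw [laplacian_green hpd hx hy]
  split_ifs <;> norm_num

lemma green_self_pos (hpd : (grounded L S).PosDef) {v : V} (hv : v ∉ S) :
    0 < green L S v v := by
  simpa [green, hv] using hpd.inv.diag_pos (i := (⟨v, hv⟩ : {x : V // x ∉ S}))

/-- The Green function decreases when the grounded set grows. -/
lemma green_anti (hoff : ∀ i j : V, i ≠ j → L i j ≤ 0) (hpdS : (grounded L S).PosDef)
    (hpdT : (grounded L T).PosDef) (hST : S ⊆ T) {v : V} (hv : v ∉ T) (x : V) :
    green L T x v ≤ green L S x v := by
  have hvS : v ∉ S := fun h => hv (hST h)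
  refine sub_nonneg.1 (nonneg_of_superharmonic hoff hpdT
    (fun x => green L S x v - green L T x v) (fun x hx => ?_) (fun x hx => ?_) x)
  · simp only [green_of_mem_left hx, sub_zero]
    exact green_nonneg hoff hpdS hvS x
  · simp only [mul_sub, Finset.sum_sub_distrib]
    rw [laplacian_green hpdS (fun h => hx (hST h)) hvS, laplacian_green hpdT hx hv, sub_self]

/-- The normalized Green function (the probability of hitting `v` before the grounded set)
decreases when the grounded set grows. -/
lemma green_div_anti (hoff : ∀ i j : V, i ≠ j → L i j ≤ 0) (hpdS : (grounded L S).PosDef)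
    (hpdT : (grounded L T).PosDef) (hST : S ⊆ T) {v : V} (hv : v ∉ T)
    (hpdv : (grounded L (insert v T)).PosDef) (x : V) :
    green L T x v / green L T v v ≤ green L S x v / green L S v v := by
  have hvS : v ∉ S := fun h => hv (hST h)
  have hS0 := green_self_pos hpdS hvS
  have hT0 := green_self_pos hpdT hv
  refine sub_nonneg.1 (nonneg_of_superharmonic hoff hpdv
    (fun x => green L S x v / green L S v v - green L T x v / green L T v v)
    (fun x hx => ?_) (fun x hx => ?_) x)
  · rcases Finset.mem_insert.1 hx with rfl | hx
    · simp [div_self hS0.ne', div_self hT0.ne']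
    · simp only [green_of_mem_left hx, zero_div, sub_zero]
      exact div_nonneg (green_nonneg hoff hpdS hvS x) hS0.le
  · rw [Finset.mem_insert, not_or] at hx
    simp only [mul_sub, Finset.sum_sub_distrib, ← mul_div_assoc, ← Finset.sum_div]
    rw [laplacian_green hpdS (fun h => hx.2 (hST h)) hvS, laplacian_green hpdT hx.2 hv,
      if_neg hx.1]
    simp

/-- Rank-one update of the Green function when one vertex is added to the grounded set. -/
lemma green_insert (hoff : ∀ i j : V, i ≠ j → L i j ≤ 0) (hpd : (grounded L S).PosDef)
    {v : V} (hv : v ∉ S) (hpdv : (grounded L (insert v S)).PosDef) {y : V}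
    (hy : y ∉ insert v S) (x : V) :
    green L S x y - green L (insert v S) x y =
      green L S x v * (green L S v y / green L S v v) := by
  have h0 := green_self_pos hpd hv
  have hy' := hy
  rw [Finset.mem_insert, not_or] at hy'
  refine sub_eq_zero.1 (eq_zero_of_harmonic hoff hpdv (fun x =>
    green L S x y - green L (insert v S) x y - green L S x v * (green L S v y / green L S v v))
    (fun x hx => ?_) (fun x hx => ?_) x)
  · simp only [green_of_mem_left hx]
    rcases Finset.mem_insert.1 hx with rfl | hx
    · field_simp
      ring
    · simp [green_of_mem_left hx]
  · have hx' := hx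
    rw [Finset.mem_insert, not_or] at hx'
    simp only [mul_sub, Finset.sum_sub_distrib, ← mul_assoc, ← Finset.sum_mul]
    rw [laplacian_green hpd hx'.2 hy'.2, laplacian_green hpdv hx hy,
      laplacian_green hpd hx'.2 hv, if_neg hx'.1]
    simp

lemma sysError_eq_sum_green : sysError L S = (1 / 2 : ℝ) * ∑ x, green L S x x := by
  rw [sysError, sum_eq_sum_subtype_notMem _ fun x hx => green_of_mem_left hx x]
  congr 1
  refine Finset.sum_congr rfl fun x _ => ?_
  simp [green, x.2]

/-- The decrease of the system error when one vertex is added to the leader set. -/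
lemma sysError_sub_sysError_insert (hsymm : L.IsSymm) (hoff : ∀ i j : V, i ≠ j → L i j ≤ 0)
    (hpd : (grounded L S).PosDef) {v : V} (hv : v ∉ S)
    (hpdv : (grounded L (insert v S)).PosDef) :
    sysError L S - sysError L (insert v S) =
      (1 / 2 : ℝ) * ∑ x, green L S x v * (green L S x v / green L S v v) := by
  rw [sysError_eq_sum_green, sysError_eq_sum_green, ← mul_sub, ← Finset.sum_sub_distrib]
  congr 1
  refine Finset.sum_congr rfl fun x _ => ?_
  by_cases hx : x ∈ insert v S
  · rw [green_of_mem_left hx]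
    rcases Finset.mem_insert.1 hx with rfl | hx
    · rw [div_self (green_self_pos hpd hv).ne', sub_zero, mul_one]
    · simp [green_of_mem_left hx]
  · rw [green_insert hoff hpd hv hpdv hx, green_comm hsymm v x]

end Green

/-- Supermodularity of the system error `R`: for nonempty `S ⊆ T ⊊ V` and `v ∈ V \ T`,
`R(S) − R(S ∪ {v}) ≥ R(T) − R(T ∪ {v})`. -/
theorem sysError_supermodular {V : Type*} [Fintype V] [DecidableEq V] [Nonempty V]
    (L : Matrix V V ℝ)
    (hsymm : L.IsSymm)
    (hoffdiag : ∀ i j : V, i ≠ j → L i j ≤ 0)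
    (hrowsum : ∀ i : V, ∑ j : V, L i j = 0)
    (hpd : ∀ S : Finset V, S.Nonempty → (grounded L S).PosDef)
    (S T : Finset V) (hS : S.Nonempty) (hST : S ⊆ T) (hT : T ⊂ Finset.univ)
    (v : V) (hv : v ∉ T) :
    sysError L S - sysError L (insert v S) ≥ sysError L T - sysError L (insert v T) := by
  have hvS : v ∉ S := fun h => hv (hST h)
  have hpdS := hpd S hS
  have hpdT := hpd T (hS.mono hST)
  have hpdvT := hpd (insert v T) (Finset.insert_nonempty v T)
  rw [sysError_sub_sysError_insert hsymm hoffdiag hpdS hvS (hpd _ (Finset.insert_nonempty v S)),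
    sysError_sub_sysError_insert hsymm hoffdiag hpdT hv hpdvT]
  refine mul_le_mul_of_nonneg_left (Finset.sum_le_sum fun x _ => ?_) (by norm_num)
  exact mul_le_mul (green_anti hoffdiag hpdS hpdT hST hv x)
    (green_div_anti hoffdiag hpdS hpdT hST hv hpdvT x)
    (div_nonneg (green_nonneg hoffdiag hpdT hv x) (green_self_pos hpdT hv).le)
    (green_nonneg hoffdiag hpdS hvS x)
end

section
/- For all nonempty subsets S ⊆ T ⊆ V, the system error satisfies R(T) ≤ R(S); that is, R is a nonincreasing function of the leader set S. -/
open Matrix Finset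

/-- For a positive definite matrix, passing to a principal submatrix does not increase the trace
of the inverse. -/
theorem Matrix.PosDef.trace_inv_submatrix_le {m n : Type*} [Fintype m] [DecidableEq m]
    [Fintype n] [DecidableEq n] {M : Matrix n n ℝ} (hM : M.PosDef) {e : m → n}
    (he : Function.Injective e) : (M.submatrix e e)⁻¹.trace ≤ M⁻¹.trace := by
  set A := M.submatrix e e with hA_def
  have hA : A.PosDef := hM.submatrix he
  set E : Matrix n m ℝ := (1 : Matrix n n ℝ).submatrix id e with hE_def
  have hEE : Eᴴ * E = 1 := by
    rw [hE_def, conjTranspose_submatrix, conjTranspose_one,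
      ← submatrix_mul _ _ e id e Function.bijective_id, one_mul, submatrix_one e he]
  have hEME : Eᴴ * (M * E) = A := by
    ext i j
    simp [hE_def, hA_def, Matrix.mul_apply, Matrix.one_apply]
  have hMu : IsUnit M.det := M.isUnit_iff_isUnit_det.mp hM.isUnit
  have hAu : IsUnit A.det := A.isUnit_iff_isUnit_det.mp hA.isUnit
  set P := E * (A⁻¹ * Eᴴ) with hP
  have hPH : Pᴴ = P := by
    rw [hP, conjTranspose_mul, conjTranspose_mul, conjTranspose_conjTranspose, hA.inv.isHermitian.eq,
      Matrix.mul_assoc]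
  have hPMP : P * (M * P) = P := by
    calc P * (M * P) = E * (A⁻¹ * ((Eᴴ * (M * E)) * (A⁻¹ * Eᴴ))) := by
          simp only [hP, Matrix.mul_assoc]
      _ = P := by rw [hEME, mul_nonsing_inv_cancel_left _ _ hAu]
  have hD : (M⁻¹ - P)ᴴ * M * (M⁻¹ - P) = M⁻¹ - P := by
    rw [conjTranspose_sub, hM.inv.isHermitian.eq, hPH, sub_mul, nonsing_inv_mul _ hMu,
      sub_mul, one_mul, mul_sub, mul_nonsing_inv_cancel_right _ _ hMu, Matrix.mul_assoc, hPMP]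
    abel
  have hpos := (hM.posSemidef.conjTranspose_mul_mul_same (M⁻¹ - P)).trace_nonneg
  have hPtr : P.trace = A⁻¹.trace := by
    rw [hP, trace_mul_comm, Matrix.mul_assoc, hEE, Matrix.mul_one]
  rwa [hD, trace_sub, hPtr, sub_nonneg] at hpos

/-- Monotonicity of the system error: for nonempty `S ⊆ T ⊆ V`, `R(T) ≤ R(S)`. -/
theorem sysError_nonincreasing {V : Type*} [Fintype V] [DecidableEq V] [Nonempty V]
    (L : Matrix V V ℝ)
    (hsymm : L.IsSymm)
    (hoffdiag : ∀ i j : V, i ≠ j → L i j ≤ 0)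
    (hrowsum : ∀ i : V, ∑ j : V, L i j = 0)
    (hpd : ∀ S : Finset V, S.Nonempty → (grounded L S).PosDef)
    (S T : Finset V) (hS : S.Nonempty) (hST : S ⊆ T) :
    sysError L T ≤ sysError L S := by
  let e : {x : V // x ∉ T} → {x : V // x ∉ S} := fun x => ⟨x, fun h => x.2 (hST h)⟩
  have he : Function.Injective e := fun x y h => Subtype.ext (Subtype.mk.inj h)
  have h_sub : (grounded L S).submatrix e e = grounded L T := by
    ext i j
    rfl
  have h_trace := (hpd S hS).trace_inv_submatrix_le he
  rw [h_sub] at h_trace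
  unfold sysError
  linarith
end

section
/- Fix a vertex u ∈ V. For all nonempty subsets S ⊆ T ⊆ V and every vertex v ∈ V with v ∉ T and u ∉ T ∪ {v}, the diagonal entry of the inverse grounded Laplacian satisfies ((L_S)⁻¹)_{uu} − ((L_{S∪{v}})⁻¹)_{uu} ≥ ((L_T)⁻¹)_{uu} − ((L_{T∪{v}})⁻¹)_{uu}; that is, S ↦ ((L_S)⁻¹)_{uu} is a supermodular function of the leader set S. -/
open Matrix Finset

/-- The diagonal entry `((L_S)⁻¹)_{uu}` of the inverse grounded Laplacian, for `u ∉ S`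
(and junk value `0` when `u ∈ S`). -/
noncomputable def invDiag {V : Type*} [Fintype V] [DecidableEq V]
    (L : Matrix V V ℝ) (S : Finset V) (u : V) : ℝ :=
  if h : u ∈ S then 0 else (grounded L S)⁻¹ ⟨u, h⟩ ⟨u, h⟩

theorem sum_eq_sum_subtype_notMem_s2 {V : Type*} [Fintype V] [DecidableEq V] (S : Finset V)
    (g : V → ℝ) (hg : ∀ x ∈ S, g x = 0) : ∑ x, g x = ∑ x : {x : V // x ∉ S}, g x := by
  rw [← Finset.sum_subtype Sᶜ (fun x => Finset.mem_compl) g]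
  refine (Finset.sum_subset (Finset.subset_univ _) fun x _ hx => hg x ?_).symm
  simpa using hx

/-- The minimum principle: a function that is nonnegative on `A` and superharmonic off `A` is
nonnegative everywhere. -/
theorem nonneg_of_superharmonic_off {V : Type*} [Fintype V] [DecidableEq V] (L : Matrix V V ℝ)
    (hoffdiag : ∀ i j : V, i ≠ j → L i j ≤ 0) (A : Finset V) (hA : (grounded L A).PosDef)
    (w : V → ℝ) (hw : ∀ x ∈ A, 0 ≤ w x) (hLw : ∀ x, x ∉ A → 0 ≤ (L *ᵥ w) x) (x : V) :
    0 ≤ w x := by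
  have hneg : ∀ x ∈ A, (w x)⁻ = 0 := fun x hx => negPart_eq_zero.2 (hw x hx)
  by_contra hx
  have hxA : x ∉ A := fun h => hx (hw x h)
  have hne : (fun y : {y : V // y ∉ A} => (w y)⁻) ≠ 0 := fun h =>
    hx (negPart_eq_zero.1 (congrFun h ⟨x, hxA⟩))
  have hpos := hA.dotProduct_mulVec_pos hne
  have hform : star (fun y : {y : V // y ∉ A} => (w y)⁻) ⬝ᵥ
      (grounded L A *ᵥ fun y : {y : V // y ∉ A} => (w y)⁻) =
        ∑ y, (w y)⁻ * ∑ z, L y z * (w z)⁻ := by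
    rw [sum_eq_sum_subtype_notMem_s2 A _ fun y hy => by rw [hneg y hy, zero_mul]]
    refine Finset.sum_congr rfl fun y _ => ?_
    rw [sum_eq_sum_subtype_notMem_s2 A (fun z => L y z * (w z)⁻) fun z hz => by
      rw [hneg z hz, mul_zero]]
    rfl
  rw [hform] at hpos
  refine hpos.not_ge (Finset.sum_nonpos fun y _ => ?_)
  have hsplit : ∑ z, L y z * (w z)⁻ = ∑ z, L y z * (w z)⁺ - (L *ᵥ w) y := by
    rw [mulVec, dotProduct, ← Finset.sum_sub_distrib]
    refine Finset.sum_congr rfl fun z _ => ?_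
    linear_combination -L y z * posPart_sub_negPart (w z)
  rw [hsplit, mul_sub, Finset.mul_sum, sub_nonpos]
  refine (Finset.sum_nonpos fun z _ => ?_).trans (b := 0) ?_
  · by_cases hyz : y = z
    · subst hyz
      rcases le_total 0 (w y) with h | h
      · simp [negPart_eq_zero.2 h]
      · simp [posPart_eq_zero.2 h]
    · exact mul_nonpos_of_nonneg_of_nonpos (negPart_nonneg _)
        (mul_nonpos_of_nonpos_of_nonneg (hoffdiag y z hyz) (posPart_nonneg _))
  · by_cases hy : y ∈ A
    · rw [hneg y hy, zero_mul]
    · exact mul_nonneg (negPart_nonneg _) (hLw y hy)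

/-- The Green function with pole `u` that vanishes on `S`. -/
theorem exists_green {V : Type*} [Fintype V] [DecidableEq V] (L : Matrix V V ℝ) (S : Finset V)
    (hS : (grounded L S).PosDef) (u : V) (hu : u ∉ S) :
    ∃ f : V → ℝ, (∀ x ∈ S, f x = 0) ∧
      (∀ x, x ∉ S → (L *ᵥ f) x = (Pi.single u 1 : V → ℝ) x) ∧ f u = invDiag L S u := by
  refine ⟨fun y => if h : y ∈ S then 0 else (grounded L S)⁻¹ ⟨y, h⟩ ⟨u, hu⟩,
    fun x hx => dif_pos hx, fun x hx => ?_, rfl⟩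
  have hmul := congrFun (congrFun (Matrix.mul_nonsing_inv (grounded L S)
    ((Matrix.isUnit_iff_isUnit_det _).1 hS.isUnit)) ⟨x, hx⟩) ⟨u, hu⟩
  rw [mulVec, dotProduct, sum_eq_sum_subtype_notMem_s2 S _ fun y hy => by rw [dif_pos hy, mul_zero]]
  rw [Matrix.mul_apply, Matrix.one_apply] at hmul
  simp only [Subtype.mk.injEq] at hmul
  rw [Pi.single_apply, ← hmul]
  refine Finset.sum_congr rfl fun y _ => ?_
  rw [dif_neg y.2]
  rfl

/-- Supermodularity of `S ↦ ((L_S)⁻¹)_{uu}`: for nonempty `S ⊆ T` and `v ∉ T` with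
`u ∉ T ∪ {v}`, `((L_S)⁻¹)_{uu} − ((L_{S∪{v}})⁻¹)_{uu} ≥ ((L_T)⁻¹)_{uu} − ((L_{T∪{v}})⁻¹)_{uu}`. -/
theorem invDiag_supermodular {V : Type*} [Fintype V] [DecidableEq V] [Nonempty V]
    (L : Matrix V V ℝ)
    (hsymm : L.IsSymm)
    (hoffdiag : ∀ i j : V, i ≠ j → L i j ≤ 0)
    (hrowsum : ∀ i : V, ∑ j : V, L i j = 0)
    (hpd : ∀ S : Finset V, S.Nonempty → (grounded L S).PosDef)
    (u : V) (S T : Finset V) (hS : S.Nonempty) (hST : S ⊆ T)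
    (v : V) (hv : v ∉ T) (hu : u ∉ insert v T) :
    invDiag L S u - invDiag L (insert v S) u ≥ invDiag L T u - invDiag L (insert v T) u := by
  obtain ⟨huv, huT⟩ : u ≠ v ∧ u ∉ T := by simpa using hu
  have huS : u ∉ S := fun h => huT (hST h)
  have hT : T.Nonempty := hS.mono hST
  have hvS := hpd _ (Finset.insert_nonempty v S)
  have hvT := hpd _ (Finset.insert_nonempty v T)
  obtain ⟨f, hf0, hf, hfu⟩ := exists_green L S (hpd S hS) u huS
  obtain ⟨f', hf'0, hf', hf'u⟩ := exists_green L _ hvS u (by simp [huv, huS])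
  obtain ⟨g, hg0, hg, hgu⟩ := exists_green L T (hpd T hT) u huT
  obtain ⟨g', hg'0, hg', hg'u⟩ := exists_green L _ hvT u hu
  have hsingle : ∀ x, 0 ≤ (Pi.single u 1 : V → ℝ) x := fun x => by
    rw [Pi.single_apply]; split_ifs <;> norm_num
  have hf_nonneg := nonneg_of_superharmonic_off L hoffdiag S (hpd S hS) f
    (fun x hx => (hf0 x hx).ge) (fun x hx => (hf x hx).symm ▸ hsingle x)
  have hgf := nonneg_of_superharmonic_off L hoffdiag T (hpd T hT) (f - g)
    (fun x hx => by simpa [hg0 x hx] using hf_nonneg x)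
    (fun x hx => by
      rw [mulVec_sub, Pi.sub_apply, hf x fun h => hx (hST h), hg x hx, sub_self])
  have hf'f := nonneg_of_superharmonic_off L hoffdiag _ hvS (f - f')
    (fun x hx => by simpa [hf'0 x hx] using hf_nonneg x)
    (fun x hx => by
      rw [mulVec_sub, Pi.sub_apply, hf x fun h => hx (Finset.mem_insert_of_mem h), hf' x hx,
        sub_self])
  have key := nonneg_of_superharmonic_off L hoffdiag _ hvT ((f - f') - (g - g'))
    (fun x hx => by
      rcases Finset.mem_insert.1 hx with rfl | hxT
      · simpa [hf'0 x (Finset.mem_insert_self _ _), hg'0 x hx] using hgf x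
      · simpa [hg0 x hxT, hg'0 x hx] using hf'f x)
    (fun x hx => by
      have hxS : x ∉ insert v S := fun h => hx (Finset.insert_subset_insert v hST h)
      simp only [mulVec_sub, Pi.sub_apply]
      rw [hf x fun h => hxS (Finset.mem_insert_of_mem h), hf' x hxS,
        hg x fun h => hx (Finset.mem_insert_of_mem h), hg' x hx]
      simp) u
  simp only [Pi.sub_apply, hfu, hf'u, hgu, hg'u] at key
  exact sub_nonneg.1 key
end

section
/- Fix a vertex u ∈ V. For all nonempty subsets S ⊆ T ⊆ V with u ∉ T, the diagonal entry of the inverse grounded Laplacian satisfies ((L_T)⁻¹)_{uu} ≤ ((L_S)⁻¹)_{uu}; that is, S ↦ ((L_S)⁻¹)_{uu} is a nonincreasing function of the leader set S. -/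
open Matrix Finset

/-- For a positive definite matrix `A`, the diagonal entries of the inverse of a principal submatrix
are bounded by the corresponding diagonal entries of `A⁻¹`. -/
theorem Matrix.PosDef.inv_submatrix_apply_self_le {m n : Type*} [Fintype m] [DecidableEq m]
    [Fintype n] [DecidableEq n] {A : Matrix n n ℝ} (hA : A.PosDef) {f : m → n}
    (hf : Function.Injective f) (i : m) :
    (A.submatrix f f)⁻¹ i i ≤ A⁻¹ (f i) (f i) := by
  have hB : (A.submatrix f f).PosDef := hA.submatrix hf
  set B := A.submatrix f f with hB_def
  set P : Matrix n m ℝ := (1 : Matrix n n ℝ).submatrix id f with hP_def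
  have hPAP : Pᵀ * A * P = B := by
    ext a b
    simp [hP_def, hB_def, Matrix.mul_apply, Matrix.one_apply]
  have hAdet : IsUnit A.det := (Matrix.isUnit_iff_isUnit_det A).1 hA.isUnit
  have hBdet : IsUnit B.det := (Matrix.isUnit_iff_isUnit_det B).1 hB.isUnit
  set Q : Matrix n n ℝ := A⁻¹ - P * B⁻¹ * Pᵀ with hQ_def
  have hQT : Qᴴ = Q := by
    have h1 : (A⁻¹)ᴴ = A⁻¹ := hA.inv.isHermitian
    have h2 : (B⁻¹)ᴴ = B⁻¹ := hB.inv.isHermitian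
    rw [hQ_def, conjTranspose_sub, conjTranspose_mul, conjTranspose_mul, h1, h2,
      conjTranspose_eq_transpose_of_trivial, conjTranspose_eq_transpose_of_trivial,
      transpose_transpose, Matrix.mul_assoc]
  have hidem : P * B⁻¹ * Pᵀ * A * (P * B⁻¹ * Pᵀ) = P * B⁻¹ * Pᵀ := by
    calc P * B⁻¹ * Pᵀ * A * (P * B⁻¹ * Pᵀ) = P * (B⁻¹ * (Pᵀ * A * P)) * B⁻¹ * Pᵀ := by
          simp only [Matrix.mul_assoc]
      _ = P * B⁻¹ * Pᵀ := by rw [hPAP, Matrix.nonsing_inv_mul _ hBdet, Matrix.mul_one]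
  have hQAQ : Qᴴ * A * Q = Q := by
    rw [hQT, hQ_def, Matrix.sub_mul, Matrix.nonsing_inv_mul _ hAdet, Matrix.sub_mul,
      Matrix.one_mul, Matrix.mul_sub, hidem, Matrix.mul_nonsing_inv_cancel_right _ _ hAdet,
      sub_self, sub_zero]
  have hQ : Q.PosSemidef := hQAQ ▸ hA.posSemidef.conjTranspose_mul_mul_same Q
  have hdiag : (P * B⁻¹ * Pᵀ) (f i) (f i) = B⁻¹ i i := by
    simp [hP_def, Matrix.mul_apply, Matrix.one_apply, hf.eq_iff]
  have h := hQ.diag_nonneg (i := f i)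
  rw [hQ_def, Matrix.sub_apply, hdiag] at h
  exact sub_nonneg.1 h

/-- Monotonicity of `S ↦ ((L_S)⁻¹)_{uu}`: for nonempty `S ⊆ T` with `u ∉ T`,
`((L_T)⁻¹)_{uu} ≤ ((L_S)⁻¹)_{uu}`. -/
theorem invDiag_nonincreasing {V : Type*} [Fintype V] [DecidableEq V] [Nonempty V]
    (L : Matrix V V ℝ)
    (hsymm : L.IsSymm)
    (hoffdiag : ∀ i j : V, i ≠ j → L i j ≤ 0)
    (hrowsum : ∀ i : V, ∑ j : V, L i j = 0)
    (hpd : ∀ S : Finset V, S.Nonempty → (grounded L S).PosDef)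
    (u : V) (S T : Finset V) (hS : S.Nonempty) (hST : S ⊆ T) (hu : u ∉ T) :
    invDiag L T u ≤ invDiag L S u := by
  have hu' : u ∉ S := fun h => hu (hST h)
  rw [invDiag, invDiag, dif_neg hu, dif_neg hu']
  let f : {x : V // x ∉ T} → {x : V // x ∉ S} := fun x => ⟨x, fun h => x.2 (hST h)⟩
  have hf : Function.Injective f := fun a b h => Subtype.ext (Subtype.mk.inj h)
  exact (hpd S hS).inv_submatrix_apply_self_le hf ⟨u, hu⟩
end

section
/- Let f : Finset V → ℝ be nonincreasing and supermodular, and let c ≥ 0 be a constant. Then the function g defined by g(S) = max{f(S), c} is supermodular. -/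
open Finset

/-- A set function `f` on subsets of `V` is supermodular if for all `S ⊆ T` and `v ∉ T`,
`f(S) − f(S ∪ {v}) ≥ f(T) − f(T ∪ {v})`. -/
def FinsetSupermodular {V : Type*} [DecidableEq V] (f : Finset V → ℝ) : Prop :=
  ∀ S T : Finset V, S ⊆ T → ∀ v : V, v ∉ T →
    f S - f (insert v S) ≥ f T - f (insert v T)

/-- A set function `f` is nonincreasing if `S ⊆ T` implies `f(T) ≤ f(S)`. -/
def FinsetNonincreasing {V : Type*} (f : Finset V → ℝ) : Prop :=
  ∀ S T : Finset V, S ⊆ T → f T ≤ f S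

/-- If `f` is nonincreasing and supermodular and `c ≥ 0`, then `g(S) = max{f(S), c}`
is supermodular. -/
theorem max_const_supermodular {V : Type*} [DecidableEq V] [Fintype V]
    (f : Finset V → ℝ) (hmono : FinsetNonincreasing f) (hsup : FinsetSupermodular f)
    (c : ℝ) (hc : 0 ≤ c) :
    FinsetSupermodular (fun S => max (f S) c) := by
  intro S T hST v hv
  have h := hsup S T hST v hv
  have hTS := hmono S T hST
  have hTSv := hmono _ _ (insert_subset_insert v hST)
  have hS := hmono _ _ (subset_insert v S)
  have hT := hmono _ _ (subset_insert v T)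
  show max (f T) c - max (f (insert v T)) c ≤ max (f S) c - max (f (insert v S)) c
  rcases max_cases (f S) c with ⟨h1, _⟩ | ⟨h1, _⟩ <;>
  rcases max_cases (f T) c with ⟨h2, _⟩ | ⟨h2, _⟩ <;>
  rcases max_cases (f (insert v S)) c with ⟨h3, _⟩ | ⟨h3, _⟩ <;>
  rcases max_cases (f (insert v T)) c with ⟨h4, _⟩ | ⟨h4, _⟩ <;>
  linarith
end

section
/- Let g : Finset V → ℝ be monotone nondecreasing and submodular with g(∅) = 0, and let k ≥ 1. Define the greedy sequence S_0 = ∅ and S_i = S_{i−1} ∪ {s_i} for 1 ≤ i ≤ k, where at each step s_i is an element of V maximizing g(S_{i−1} ∪ {v}) over v ∈ V. Then g(S_k) ≥ (1 − (1 − 1/k)^k) · max{g(T) : T ⊆ V, |T| ≤ k}. In particular g(S_k) ≥ (1 − 1/e) · max{g(T) : |T| ≤ k}. -/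
open Finset

/-- A set function `g` on subsets of `V` is submodular if for all `S ⊆ T` and `v ∉ T`,
`g(S ∪ {v}) − g(S) ≥ g(T ∪ {v}) − g(T)`. -/
def FinsetSubmodular {V : Type*} [DecidableEq V] (g : Finset V → ℝ) : Prop :=
  ∀ S T : Finset V, S ⊆ T → ∀ v : V, v ∉ T →
    g (insert v S) - g S ≥ g (insert v T) - g T

/-- A set function `g` is monotone nondecreasing if `S ⊆ T` implies `g(S) ≤ g(T)`. -/
def FinsetNondecreasing {V : Type*} (g : Finset V → ℝ) : Prop :=
  ∀ S T : Finset V, S ⊆ T → g S ≤ g T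

/-- If every single-element marginal gain over `A` is at most `d`, then the gain of adding `T`
is at most `|T| * d`. -/
theorem FinsetSubmodular.union_sub_le {V : Type*} [DecidableEq V] {g : Finset V → ℝ}
    (hsub : FinsetSubmodular g) {A : Finset V} {d : ℝ} (hd : ∀ v, g (insert v A) - g A ≤ d)
    (hd0 : 0 ≤ d) (T : Finset V) : g (A ∪ T) - g A ≤ #T * d := by
  induction T using Finset.induction_on with
  | empty => simp
  | insert a T ha ih =>
    rw [Finset.card_insert_of_notMem ha, Finset.union_insert]
    push_cast
    by_cases h : a ∈ A ∪ T
    · rw [Finset.insert_eq_of_mem h]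
      linarith
    · linarith [hsub A (A ∪ T) Finset.subset_union_left a h, hd a]

/-- If the largest single-element marginal gain over `A` is attained at `a`, then adding `a`
shrinks the gap to any set of at most `k` elements by a factor `1 - 1 / k`. -/
theorem FinsetSubmodular.sub_insert_le {V : Type*} [DecidableEq V] {g : Finset V → ℝ}
    (hsub : FinsetSubmodular g) (hmono : FinsetNondecreasing g) {k : ℕ} (hk : 1 ≤ k)
    {A : Finset V} {a : V} (ha : ∀ v, g (insert v A) ≤ g (insert a A))
    {T : Finset V} (hT : #T ≤ k) :
    g T - g (insert a A) ≤ (1 - 1 / (k : ℝ)) * (g T - g A) := by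
  have hk0 : (0 : ℝ) < k := by exact_mod_cast hk
  have hd0 : 0 ≤ g (insert a A) - g A := sub_nonneg.2 (hmono _ _ (Finset.subset_insert _ _))
  have hgap : g T - g A ≤ k * (g (insert a A) - g A) :=
    calc g T - g A ≤ g (A ∪ T) - g A := by gcongr; exact hmono _ _ Finset.subset_union_right
      _ ≤ #T * (g (insert a A) - g A) :=
        hsub.union_sub_le (fun v => sub_le_sub_right (ha v) _) hd0 T
      _ ≤ k * (g (insert a A) - g A) := by gcongr
  have hdiv : (g T - g A) / k ≤ g (insert a A) - g A := (div_le_iff₀' hk0).2 hgap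
  calc g T - g (insert a A) ≤ (g T - g A) - (g T - g A) / k := by linarith
    _ = (1 - 1 / (k : ℝ)) * (g T - g A) := by ring

/-- Greedy guarantee for cardinality-constrained submodular maximization: if `g` is monotone
nondecreasing and submodular with `g(∅) = 0` and `S_0 = ∅`, `S_i = S_{i-1} ∪ {s_i}` where `s_i`
maximizes `g(S_{i-1} ∪ {v})` over `v ∈ V`, then
`g(S_k) ≥ (1 − (1 − 1/k)^k) · max{g(T) : |T| ≤ k}`, and in particular
`g(S_k) ≥ (1 − 1/e) · max{g(T) : |T| ≤ k}`. -/
theorem greedy_submodular_max_bound {V : Type*} [DecidableEq V] [Fintype V] [Nonempty V]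
    (g : Finset V → ℝ) (hmono : FinsetNondecreasing g) (hsub : FinsetSubmodular g)
    (hempty : g ∅ = 0) (k : ℕ) (hk : 1 ≤ k)
    (S : ℕ → Finset V) (s : ℕ → V)
    (hS0 : S 0 = ∅)
    (hstep : ∀ i : ℕ, 1 ≤ i → i ≤ k →
      S i = insert (s i) (S (i - 1)) ∧
        ∀ v : V, g (insert v (S (i - 1))) ≤ g (insert (s i) (S (i - 1)))) :
    g (S k) ≥ (1 - (1 - 1 / (k : ℝ)) ^ k) *
        ((Finset.univ.powerset.filter fun T : Finset V => T.card ≤ k).sup'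
          ⟨∅, by simp⟩ g) ∧
      g (S k) ≥ (1 - 1 / Real.exp 1) *
        ((Finset.univ.powerset.filter fun T : Finset V => T.card ≤ k).sup'
          ⟨∅, by simp⟩ g) := by
  have hk0 : (0 : ℝ) < k := by exact_mod_cast hk
  have hr : 0 ≤ 1 - 1 / (k : ℝ) := by
    rw [sub_nonneg, div_le_one hk0]
    exact_mod_cast hk
  obtain ⟨T, hT, hmax⟩ := Finset.exists_mem_eq_sup'
    (s := Finset.univ.powerset.filter fun T : Finset V => T.card ≤ k) ⟨∅, by simp⟩ g
  rw [hmax]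
  have hcard : #T ≤ k := (Finset.mem_filter.1 hT).2
  have hT0 : 0 ≤ g T := hempty ▸ hmono ∅ T (Finset.empty_subset T)
  have hgap : ∀ i ≤ k, g T - g (S i) ≤ (1 - 1 / (k : ℝ)) ^ i * g T := by
    intro i
    induction i with
    | zero => simp [hS0, hempty]
    | succ i ih =>
      intro hi
      obtain ⟨hS, hs⟩ := hstep (i + 1) (Nat.succ_pos i) hi
      rw [Nat.add_sub_cancel] at hS hs
      rw [hS, pow_succ', mul_assoc]
      exact (hsub.sub_insert_le hmono hk hs hcard).trans
        (mul_le_mul_of_nonneg_left (ih (Nat.le_of_succ_le hi)) hr)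
  have hbound : (1 - (1 - 1 / (k : ℝ)) ^ k) * g T ≤ g (S k) := by
    linarith [hgap k le_rfl]
  refine ⟨hbound, le_trans ?_ hbound⟩
  gcongr
  rw [one_div (Real.exp 1), ← Real.exp_neg]
  exact Real.one_sub_div_pow_le_exp_neg (by exact_mod_cast hk)
end

section
/- Let L be a weighted Laplacian of a connected graph on V, let S ⊆ V be nonempty with S ≠ V, and let u ∈ V \ S. Suppose v, J : V → ℝ satisfy L·v = J (matrix–vector product), v_u = 1, v_s = 0 for all s ∈ S, and J_i = 0 for all i ∉ S ∪ {u}. Then J_u ≠ 0 and the diagonal entry of the inverse grounded Laplacian satisfies ((L_S)⁻¹)_{uu} = 1 / J_u. -/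
open Matrix Finset

/-- If `v` vanishes on `S`, then the grounded Laplacian acts on the restriction of `v` as `L` acts
on `v`. -/
theorem grounded_mulVec_restrict {V : Type*} [Fintype V] [DecidableEq V]
    (L : Matrix V V ℝ) (S : Finset V) (v : V → ℝ) (hv : ∀ s ∈ S, v s = 0)
    (i : {x : V // x ∉ S}) :
    (grounded L S).mulVec (fun j => v j) i = L.mulVec v i := by
  simp only [Matrix.mulVec, dotProduct, grounded, Matrix.submatrix_apply]
  rw [← Finset.sum_subtype Sᶜ (fun x => Finset.mem_compl) (fun j => L i j * v j)]
  refine Finset.sum_subset (Finset.subset_univ _) fun x _ hx => ?_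
  rw [hv x (by simpa using hx), mul_zero]

/-- If `L·v = J` with `v_u = 1`, `v_s = 0` for `s ∈ S`, and `J_i = 0` for `i ∉ S ∪ {u}`,
then `J_u ≠ 0` and `((L_S)⁻¹)_{uu} = 1 / J_u`. -/
theorem invDiag_eq_inv_of_harmonic {V : Type*} [Fintype V] [DecidableEq V] [Nonempty V]
    (L : Matrix V V ℝ)
    (hsymm : L.IsSymm)
    (hoffdiag : ∀ i j : V, i ≠ j → L i j ≤ 0)
    (hrowsum : ∀ i : V, ∑ j : V, L i j = 0)
    (hpd : ∀ S : Finset V, S.Nonempty → (grounded L S).PosDef)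
    (S : Finset V) (hS : S.Nonempty) (hSne : S ≠ Finset.univ)
    (u : V) (hu : u ∉ S)
    (v J : V → ℝ)
    (hvJ : L.mulVec v = J)
    (hvu : v u = 1)
    (hvS : ∀ s : V, s ∈ S → v s = 0)
    (hJ : ∀ i : V, i ∉ S → i ≠ u → J i = 0) :
    J u ≠ 0 ∧ (grounded L S)⁻¹ ⟨u, hu⟩ ⟨u, hu⟩ = 1 / J u := by
  set G := grounded L S with hG
  have hdet : IsUnit G.det := (Matrix.isUnit_iff_isUnit_det G).mp (hpd S hS).isUnit
  have hsource : G.mulVec (fun j => v j) = Pi.single ⟨u, hu⟩ (J u) := by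
    ext i
    rw [hG, grounded_mulVec_restrict L S v hvS, hvJ]
    by_cases hi : i = ⟨u, hu⟩
    · subst hi
      simp
    · rw [Pi.single_eq_of_ne hi, hJ i i.2 fun h => hi (Subtype.ext h)]
  have hprod : G⁻¹ ⟨u, hu⟩ ⟨u, hu⟩ * J u = 1 := by
    have h := congrFun (congrArg G⁻¹.mulVec hsource) ⟨u, hu⟩
    rw [Matrix.mulVec_mulVec, Matrix.nonsing_inv_mul _ hdet, Matrix.one_mulVec] at h
    simpa [hvu] using h.symm
  have hJu : J u ≠ 0 := right_ne_zero_of_mul_eq_one hprod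
  exact ⟨hJu, eq_div_of_mul_eq hJu hprod⟩
end
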